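/- Let M = (M^m)_{m≥0} be a mould with M^0 = 0 and M^1 = 0, such that M^2(u_1,u_2) + M^2(u_2,u_1) = 0 identically, and suppose c ∈ ℚ satisfies ũ(M)^3(x_1,x_2,x_3) + ũ(M)^3(x_1,x_3,x_2) + 2c = 0 identically. Then c = 0, the cyclic invariance ũ(M)^3(x_1,x_2,x_3) = ũ(M)^3(x_2,x_3,x_1) holds identically, and consequently M satisfies Ecalle's senary relation at depth r = 2. -/

import Mathlib

open MvPolynomial
open scoped TensorProduct

open MvPolynomial

/-- A mould: a family `M = (M^m)_{m ≥ 0}` with `M^m ∈ ℚ[x_1,…,x_m]`. -/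
abbrev Mould : Type := (m : ℕ) → MvPolynomial (Fin m) ℚ

/-- Evaluation of the depth-`m` component of a mould at a vector `v`. -/
noncomputable def mEval {K : Type} [CommRing K] (f : ℚ →+* K) (M : Mould) {m : ℕ}
    (v : Fin m → K) : K :=
  MvPolynomial.eval₂ f v (M m)

/-- The rational function field `ℚ(x_1,…,x_n)`. -/
abbrev FF (n : ℕ) : Type := FractionRing (MvPolynomial (Fin n) ℚ)

/-- The variable `x_i` as an element of `ℚ(x_1,…,x_n)`. -/
noncomputable def xv {n : ℕ} (i : Fin n) : FF n :=
  algebraMap (MvPolynomial (Fin n) ℚ) (FF n) (X i)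

/-- Ecalle's senary relation at depth `r = s+1`, as an identity in `ℚ(y_1,…,y_r)`:
`M^r(y_1,…,y_r) + (M^{r-1}(y_1,…,y_{r-2},y_{r-1}+y_r) - M^{r-1}(y_1,…,y_{r-1}))/y_r
 = M^r(-y_1-⋯-y_r, y_1,…,y_{r-1})
   + (M^{r-1}(-y_2-⋯-y_r, y_2,…,y_{r-1}) - M^{r-1}(y_1,…,y_{r-1}))/(y_1+⋯+y_r)`. -/
noncomputable def SenaryAt (M : Mould) (s : ℕ) : Prop :=
  mEval (Rat.castHom (FF (s+1))) M (fun i : Fin (s+1) => xv i)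
    + (mEval (Rat.castHom (FF (s+1))) M (fun i : Fin s =>
          if i.val = s - 1 then xv (⟨s-1, by omega⟩ : Fin (s+1)) + xv (Fin.last s)
          else xv i.castSucc)
       - mEval (Rat.castHom (FF (s+1))) M (fun i : Fin s => xv i.castSucc)) / xv (Fin.last s)
  = mEval (Rat.castHom (FF (s+1))) M (fun i : Fin (s+1) =>
        if i.val = 0 then -(∑ j : Fin (s+1), xv j)
        else xv (⟨i.val - 1, by have := i.isLt; omega⟩ : Fin (s+1)))
    + (mEval (Rat.castHom (FF (s+1))) M (fun i : Fin s =>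
          if i.val = 0 then -(∑ j : Fin s, xv j.succ) else xv i.castSucc)
       - mEval (Rat.castHom (FF (s+1))) M (fun i : Fin s => xv i.castSucc))
      / (∑ j : Fin (s+1), xv j)
/-- Evaluation of `ũ(M)^{m+1}` (where `ũ = t̃ ∘ swap`):
`ũ(M)^{m+1}(v_1,…,v_{m+1}) = M^m(v_{m+1}-v_1, v_m-v_{m+1}, v_{m-1}-v_m, …, v_2-v_3)`. -/
noncomputable def uEval {K : Type} [CommRing K] (f : ℚ →+* K) (M : Mould) {m : ℕ}
    (v : Fin (m+1) → K) : K :=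
  mEval f M (fun j : Fin m =>
    if h : j.val = 0 then v (Fin.last m) - v 0
    else v ⟨m - j.val, by omega⟩ - v ⟨m - j.val + 1, by have := j.isLt; omega⟩)

/-- `coll^{t+2}_{i,i+1}` (with `1`-indexed `i = k+1`) applied to `N = ũ(M)`,
evaluated at `v = (x_1,…,x_{t+2})`:
`(N^{t+1}(x_1,…,x_i,x_{i+2},…) - N^{t+1}(x_1,…,x_{i-1},x_{i+1},x_{i+2},…))/(x_i - x_{i+1})`. -/
noncomputable def collUEval {K : Type} [Field K] (f : ℚ →+* K) (M : Mould) {t : ℕ}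
    (k : Fin (t+1)) (v : Fin (t+2) → K) : K :=
  (uEval f M (fun j : Fin (t+1) => v (Fin.succAbove k.succ j))
    - uEval f M (fun j : Fin (t+1) => v (Fin.succAbove k.castSucc j)))
    / (v k.castSucc - v k.succ)

/-- `ũ(M)^3(p, q, r) = M^2(r - p, q - r)`. -/
theorem uEval_two_eq {K : Type} [CommRing K] (f : ℚ →+* K) (M : Mould) (p q r : K) :
    uEval f M ![p, q, r] = mEval f M ![r - p, q - r] := by
  unfold uEval
  congr 1
  funext j
  fin_cases j <;> simp [Fin.last]

/-- Ring homomorphisms commute with the evaluation of a mould. -/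
theorem map_mEval {K L : Type} [CommRing K] [CommRing L] (φ : K →+* L) (f : ℚ →+* K)
    (M : Mould) {m : ℕ} (v : Fin m → K) :
    φ (mEval f M v) = mEval (φ.comp f) M (fun i => φ (v i)) := by
  simp only [mEval, MvPolynomial.hom_eval₂]

theorem mEval_swap {K : Type} [CommRing K] (f : ℚ →+* K) (M : Mould)
    (hsym : M 2 + MvPolynomial.eval₂ MvPolynomial.C
        (![X 1, X 0] : Fin 2 → MvPolynomial (Fin 2) ℚ) (M 2) = 0) (a b : K) :
    mEval f M ![a, b] = -mEval f M ![b, a] := by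
  have h := congrArg (MvPolynomial.eval₂Hom f ![a, b]) hsym
  rw [map_add, map_zero] at h
  change mEval f M ![a, b] + MvPolynomial.eval₂Hom f ![a, b] (mEval C M ![X 1, X 0]) = 0 at h
  have hv : (fun i => MvPolynomial.eval₂Hom f ![a, b]
      ((![X 1, X 0] : Fin 2 → MvPolynomial (Fin 2) ℚ) i)) = ![b, a] := by
    funext i
    fin_cases i <;> simp
  rw [map_mEval, hv, RingHom.ext_rat ((MvPolynomial.eval₂Hom f ![a, b]).comp C) f] at h
  exact eq_neg_of_add_eq_zero_left h

theorem mEval_add_neg {K : Type} [CommRing K] (f : ℚ →+* K) (M : Mould) (c : ℚ)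
    (hc : uEval (MvPolynomial.C : ℚ →+* MvPolynomial (Fin 3) ℚ) M ![X 0, X 1, X 2]
        + uEval MvPolynomial.C M ![X 0, X 2, X 1] + MvPolynomial.C (2 * c) = 0) (a b : K) :
    mEval f M ![a, b] + mEval f M ![a + b, -b] + f (2 * c) = 0 := by
  have h := congrArg (MvPolynomial.eval₂Hom f ![0, a + b, a]) hc
  rw [uEval_two_eq, uEval_two_eq, map_add, map_add, map_zero, map_mEval, map_mEval,
    RingHom.ext_rat ((MvPolynomial.eval₂Hom f ![0, a + b, a]).comp C) f,
    MvPolynomial.coe_eval₂Hom, MvPolynomial.eval₂_C] at h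
  convert h using 4 <;> funext i <;> fin_cases i <;> simp

theorem eq_zero_of_mEval_relations (M : Mould) (c : ℚ)
    (hsym : M 2 + MvPolynomial.eval₂ MvPolynomial.C
        (![X 1, X 0] : Fin 2 → MvPolynomial (Fin 2) ℚ) (M 2) = 0)
    (hc : uEval (MvPolynomial.C : ℚ →+* MvPolynomial (Fin 3) ℚ) M ![X 0, X 1, X 2]
        + uEval MvPolynomial.C M ![X 0, X 2, X 1] + MvPolynomial.C (2 * c) = 0) : c = 0 := by
  have h := mEval_add_neg (RingHom.id ℚ) M c hc 0 0
  have hs := mEval_swap (RingHom.id ℚ) M hsym 0 0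
  simp only [add_zero, neg_zero, RingHom.id_apply] at h
  linarith

/-- Invariance of the depth-two component under the order-three map `(a, b) ↦ (-a-b, a)`. -/
theorem mEval_cyclic {K : Type} [CommRing K] (f : ℚ →+* K) (M : Mould) (c : ℚ)
    (hsym : M 2 + MvPolynomial.eval₂ MvPolynomial.C
        (![X 1, X 0] : Fin 2 → MvPolynomial (Fin 2) ℚ) (M 2) = 0)
    (hc : uEval (MvPolynomial.C : ℚ →+* MvPolynomial (Fin 3) ℚ) M ![X 0, X 1, X 2]
        + uEval MvPolynomial.C M ![X 0, X 2, X 1] + MvPolynomial.C (2 * c) = 0) (a b : K) :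
    mEval f M ![a, b] = mEval f M ![-(a + b), a] := by
  have h₁ := mEval_add_neg f M c hc a b
  have h₂ := mEval_add_neg f M c hc (-b) (a + b)
  rw [show -b + (a + b) = a by ring] at h₂
  have h₃ := mEval_swap f M hsym (a + b) (-b)
  have h₄ := mEval_swap f M hsym a (-(a + b))
  have h₅ : f (2 * c) = 0 := by simp [eq_zero_of_mEval_relations M c hsym hc]
  linear_combination h₁ + h₂ - h₃ - h₄ - 2 * h₅

/-- Let `M` be a mould with `M^0 = 0`, `M^1 = 0`,
`M^2(u_1,u_2) + M^2(u_2,u_1) = 0` identically, and suppose `c ∈ ℚ` satisfies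
`ũ(M)^3(x_1,x_2,x_3) + ũ(M)^3(x_1,x_3,x_2) + 2c = 0` identically.  Then `c = 0`,
the cyclic invariance `ũ(M)^3(x_1,x_2,x_3) = ũ(M)^3(x_2,x_3,x_1)` holds, and `M`
satisfies Ecalle's senary relation at depth `r = 2`. -/
theorem c_eq_zero_cyclic_and_senary_depth_two (M : Mould)
    (h0 : M 0 = 0) (h1 : M 1 = 0) (c : ℚ)
    (hsym : M 2 + MvPolynomial.eval₂ MvPolynomial.C
        (![X 1, X 0] : Fin 2 → MvPolynomial (Fin 2) ℚ) (M 2) = 0)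
    (hc : uEval (MvPolynomial.C : ℚ →+* MvPolynomial (Fin 3) ℚ) M ![X 0, X 1, X 2]
        + uEval MvPolynomial.C M ![X 0, X 2, X 1] + MvPolynomial.C (2 * c) = 0) :
    c = 0 ∧
    uEval (MvPolynomial.C : ℚ →+* MvPolynomial (Fin 3) ℚ) M ![X 0, X 1, X 2]
      = uEval MvPolynomial.C M ![X 1, X 2, X 0] ∧
    SenaryAt M 1 := by
  refine ⟨eq_zero_of_mEval_relations M c hsym hc, ?_, ?_⟩
  · rw [uEval_two_eq, uEval_two_eq, mEval_cyclic _ M c hsym hc]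
    congr 3
    ring
  · have hone (v : Fin 1 → FF 2) : mEval (Rat.castHom (FF 2)) M v = 0 := by
      simp [mEval, h1]
    unfold SenaryAt
    simp only [Nat.reduceAdd, hone, sub_self, zero_div, add_zero]
    convert mEval_cyclic (Rat.castHom (FF 2)) M c hsym hc (xv 0) (xv 1) using 2 <;>
      funext i <;> fin_cases i <;> simp
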